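/- arXiv:2206.05608 — 3 statements merged into one kernel-verified Lean document; each statement's English description precedes it below -/
import Mathlib

section
/- Let H be a real Hilbert space and F : H → ℝ a twice Fréchet differentiable function whose second derivative satisfies m·‖v‖² ≤ D²F(f)[v,v] ≤ μ·‖v‖² for all f, v ∈ H, where 0 < m ≤ μ. Then F attains a unique global minimizer f⋆ ∈ H, and for every step size ε with 0 < ε < 2/μ and every initial point f₀ ∈ H, the gradient descent iterates f_{k+1} = f_k − ε·∇F(f_k) converge to f⋆. -/
/-- A symmetric bounded bilinear form is bounded in norm by any bound of its quadratic form. -/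
theorem opNorm_le_of_symmetric_of_abs_apply_self_le {H : Type*} [NormedAddCommGroup H]
    [InnerProductSpace ℝ H] (B : H →L[ℝ] H →L[ℝ] ℝ) (q : ℝ) (hq : 0 ≤ q)
    (hsymm : ∀ v w, B v w = B w v) (hB : ∀ v, |B v v| ≤ q * ‖v‖ ^ 2) : ‖B‖ ≤ q := by
  have key : ∀ v w, |B v w| ≤ q / 2 * (‖v‖ ^ 2 + ‖w‖ ^ 2) := by
    intro v w
    have h1 := abs_le.1 (hB (v + w))
    have h2 := abs_le.1 (hB (v - w))
    have h3 := parallelogram_law_with_norm ℝ v w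
    have h4 : q * ‖v + w‖ ^ 2 + q * ‖v - w‖ ^ 2 = 2 * q * (‖v‖ ^ 2 + ‖w‖ ^ 2) := by
      linear_combination q * h3
    simp only [map_add, map_sub, add_apply,
      sub_apply, hsymm w v] at h1 h2
    rw [abs_le]
    constructor <;> linarith
  refine B.opNorm_le_bound₂ hq fun v w => ?_
  rcases eq_or_ne v 0 with rfl | hv
  · simp
  rcases eq_or_ne w 0 with rfl | hw
  · simp
  have hv' : 0 < ‖v‖ := norm_pos_iff.2 hv
  have hw' : 0 < ‖w‖ := norm_pos_iff.2 hw
  have h := key (‖w‖ • v) (‖v‖ • w)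
  simp only [map_smul, smul_apply, smul_eq_mul, norm_smul, norm_norm,
    abs_mul, abs_norm] at h
  rw [Real.norm_eq_abs]
  refine le_of_mul_le_mul_left ?_ (mul_pos hv' hw')
  linarith

/-- For a step size `ε < 2 / μ`, the gradient descent step of a function whose Hessian lies between
`m` and `μ` is a strict contraction. -/
theorem exists_norm_gradient_step_sub_le {H : Type*} [NormedAddCommGroup H]
    [InnerProductSpace ℝ H] [CompleteSpace H]
    (F : H → ℝ) (m μ : ℝ) (hm : 0 < m) (hmμ : m ≤ μ)
    (hF : Differentiable ℝ F) (hF' : Differentiable ℝ (fderiv ℝ F))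
    (hlow : ∀ f v : H, m * ‖v‖ ^ 2 ≤ fderiv ℝ (fderiv ℝ F) f v v)
    (hup : ∀ f v : H, fderiv ℝ (fderiv ℝ F) f v v ≤ μ * ‖v‖ ^ 2)
    (ε : ℝ) (hε : 0 < ε) (hεμ : ε < 2 / μ) :
    ∃ q : ℝ, 0 ≤ q ∧ q < 1 ∧ ∀ x y : H,
      ‖(x - ε • gradient F x) - (y - ε • gradient F y)‖ ≤ q * ‖x - y‖ := by
  have hμ : 0 < μ := hm.trans_le hmμ
  have hεμ' : ε * μ < 2 := (lt_div_iff₀ hμ).1 hεμ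
  have hεm : 0 < ε * m := mul_pos hε hm
  have hle : ε * m ≤ ε * μ := mul_le_mul_of_nonneg_left hmμ hε.le
  set q := max |1 - ε * m| |1 - ε * μ| with hq
  have hq0 : 0 ≤ q := (abs_nonneg _).trans (le_max_left _ _)
  refine ⟨q, hq0, ?_, fun x y => ?_⟩
  · refine max_lt ?_ ?_ <;> rw [abs_lt] <;> constructor <;> linarith
  have hsymm : ∀ z v w, fderiv ℝ (fderiv ℝ F) z v w = fderiv ℝ (fderiv ℝ F) z w v :=
    fun z v w => second_derivative_symmetric (fun y => (hF y).hasFDerivAt)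
      (hF' z).hasFDerivAt v w
  let J : H →L[ℝ] H →L[ℝ] ℝ := innerSL ℝ
  have hJ : ∀ v w, J v w = inner ℝ v w := innerSL_apply_apply ℝ
  have hderiv : ∀ z, HasFDerivAt (fun z => J z - ε • fderiv ℝ F z)
      (J - ε • fderiv ℝ (fderiv ℝ F) z) z :=
    fun z => J.hasFDerivAt.sub ((hF' z).hasFDerivAt.const_smul ε)
  have hbound : ∀ z, ‖J - ε • fderiv ℝ (fderiv ℝ F) z‖ ≤ q := by
    intro z
    refine opNorm_le_of_symmetric_of_abs_apply_self_le _ q hq0 (fun v w => ?_) fun v => ?_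
    · simp [hJ, hsymm z v w, real_inner_comm]
    · have h1 := mul_le_mul_of_nonneg_left (hlow z v) hε.le
      have h2 := mul_le_mul_of_nonneg_left (hup z v) hε.le
      have h3 := mul_le_mul_of_nonneg_right
        ((le_abs_self _).trans (le_max_left |1 - ε * m| |1 - ε * μ|)) (sq_nonneg ‖v‖)
      have h4 := mul_le_mul_of_nonneg_right
        ((neg_le_abs _).trans (le_max_right |1 - ε * m| |1 - ε * μ|)) (sq_nonneg ‖v‖)
      rw [← hq] at h3 h4
      simp only [sub_apply, smul_apply, hJ,
        real_inner_self_eq_norm_sq, smul_eq_mul]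
      rw [abs_le]
      constructor <;> linarith
  have hmvt := convex_univ.norm_image_sub_le_of_norm_hasFDerivWithin_le
    (fun z _ => (hderiv z).hasFDerivWithinAt) (fun z _ => hbound z)
    (Set.mem_univ y) (Set.mem_univ x)
  have hdual : ∀ z, InnerProductSpace.toDual ℝ H (z - ε • gradient F z)
      = J z - ε • fderiv ℝ F z := by
    intro z
    rw [map_sub, map_smul, gradient, LinearIsometryEquiv.apply_symm_apply]
    rfl
  rwa [← hdual, ← hdual, ← map_sub, LinearIsometryEquiv.norm_map] at hmvt

/-- A function whose derivative is nonnegative in the directions pointing away from `a` is minimal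
at `a`. -/
theorem le_of_forall_fderiv_apply_sub_nonneg {E : Type*} [NormedAddCommGroup E] [NormedSpace ℝ E]
    {F : E → ℝ} (hF : Differentiable ℝ F) (a : E) (h : ∀ x, 0 ≤ fderiv ℝ F x (x - a)) (x : E) :
    F a ≤ F x := by
  have hd : ∀ t : ℝ, HasDerivAt (fun t : ℝ => F (a + t • (x - a)))
      (fderiv ℝ F (a + t • (x - a)) (x - a)) t := by
    intro t
    have h1 : HasDerivAt (fun t : ℝ => a + t • (x - a)) (x - a) t := by
      simpa using ((hasDerivAt_id t).smul_const (x - a)).const_add a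
    exact (hF _).hasFDerivAt.comp_hasDerivAt t h1
  obtain ⟨c, hc, hc'⟩ := exists_hasDerivAt_eq_slope (fun t : ℝ => F (a + t • (x - a))) _
    zero_lt_one (fun t _ => (hd t).continuousAt.continuousWithinAt) (fun t _ => hd t)
  have h2 := h (a + c • (x - a))
  rw [add_sub_cancel_left, map_smul, smul_eq_mul] at h2
  have h3 := nonneg_of_mul_nonneg_right h2 hc.1
  rw [hc'] at h3
  simpa using h3

/-- Gradient descent on a strongly convex, smooth function on a real Hilbert space
converges to the unique global minimizer. -/
theorem stmt_0 {H : Type*} [NormedAddCommGroup H] [InnerProductSpace ℝ H] [CompleteSpace H]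
    (F : H → ℝ) (m μ : ℝ) (hm : 0 < m) (hmμ : m ≤ μ)
    (hF : Differentiable ℝ F) (hF' : Differentiable ℝ (fderiv ℝ F))
    (hlow : ∀ f v : H, m * ‖v‖ ^ 2 ≤ fderiv ℝ (fderiv ℝ F) f v v)
    (hup : ∀ f v : H, fderiv ℝ (fderiv ℝ F) f v v ≤ μ * ‖v‖ ^ 2) :
    ∃ fstar : H, (∀ f : H, F fstar ≤ F f) ∧
      (∀ g : H, (∀ f : H, F g ≤ F f) → g = fstar) ∧
      (∀ ε : ℝ, 0 < ε → ε < 2 / μ → ∀ (f0 : H) (seq : ℕ → H),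
        seq 0 = f0 → (∀ k : ℕ, seq (k + 1) = seq k - ε • gradient F (seq k)) →
        Filter.Tendsto seq Filter.atTop (nhds fstar)) := by
  have hstep := exists_norm_gradient_step_sub_le F m μ hm hmμ hF hF' hlow hup
  have hμ : 0 < μ := hm.trans_le hmμ
  have hδ : 0 < 1 / μ := by positivity
  obtain ⟨q, hq0, hq1, hq⟩ := hstep (1 / μ) hδ (by gcongr; norm_num)
  set δ := 1 / μ
  have hcontr : ContractingWith ⟨q, hq0⟩ fun x => x - δ • gradient F x :=
    ⟨hq1, LipschitzWith.of_dist_le_mul fun x y => by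
      rw [dist_eq_norm, dist_eq_norm]; exact hq x y⟩
  have hfix : ∃ a, gradient F a = 0 := by
    refine ⟨ContractingWith.fixedPoint _ hcontr, ?_⟩
    have h := hcontr.fixedPoint_isFixedPt
    rw [Function.IsFixedPt, sub_eq_self, smul_eq_zero] at h
    exact h.resolve_left hδ.ne'
  obtain ⟨a, ha⟩ := hfix
  refine ⟨a, le_of_forall_fderiv_apply_sub_nonneg hF a fun x => ?_, fun g hg => ?_, ?_⟩
  · have h := hq x a
    rw [ha, smul_zero, sub_zero, sub_right_comm] at h
    have h1 := real_inner_le_norm (x - a - δ • gradient F x) (x - a)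
    have h2 := mul_le_mul_of_nonneg_right h (norm_nonneg (x - a))
    rw [inner_sub_left, real_inner_smul_left, real_inner_self_eq_norm_sq, gradient,
      InnerProductSpace.toDual_symm_apply, ← gradient] at h1
    refine nonneg_of_mul_nonneg_right (a := δ) ?_ hδ
    nlinarith [sq_nonneg ‖x - a‖]
  · have hg' : gradient F g = 0 := by
      have hmin : IsLocalMin F g := Filter.Eventually.of_forall hg
      rw [gradient, hmin.fderiv_eq_zero, map_zero]
    exact hcontr.fixedPoint_unique' (by simp [Function.IsFixedPt, hg'])
      (by simp [Function.IsFixedPt, ha])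
  · intro ε hε hεμ f0 seq _ hseq
    obtain ⟨r, hr0, hr1, hr⟩ := hstep ε hε hεμ
    have hgeom : ∀ k, ‖seq k - a‖ ≤ r ^ k * ‖seq 0 - a‖ := by
      intro k
      induction k with
      | zero => simp
      | succ k ih =>
        have h := hr (seq k) a
        rw [ha, smul_zero, sub_zero, ← hseq] at h
        calc ‖seq (k + 1) - a‖ ≤ r * ‖seq k - a‖ := h
          _ ≤ r * (r ^ k * ‖seq 0 - a‖) := by gcongr
          _ = r ^ (k + 1) * ‖seq 0 - a‖ := by ring
    rw [tendsto_iff_norm_sub_tendsto_zero]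
    refine squeeze_zero (fun _ => norm_nonneg _) hgeom ?_
    simpa using (tendsto_pow_atTop_nhds_zero_of_lt_one hr0 hr1).mul_const ‖seq 0 - a‖
end

section
/- Let Σ̄ be the (N+1)×(N+1) real block matrix Σ̄ = [[σ²κ + δ², σ²vᵀ], [σ²v, σ²K + δ²I_N]] and assume Σ̄ is positive semidefinite. Let W = (W₀, W₁, …, W_N) : Ω → ℝ^{N+1} be a centered Gaussian vector with covariance Σ̄, in the sense that for every a ∈ ℝ^{N+1} the distribution of ω ↦ Σ_{i=0}^N aᵢ·Wᵢ(ω) is the real Gaussian measure with mean 0 and variance aᵀΣ̄a. Then the distribution of ĝ := W₀ + ⟨v, M⁻¹(y − (W₁, …, W_N))⟩ is the real Gaussian measure with mean ⟨v, M⁻¹ y⟩ and variance δ² + σ²·(κ − ⟨v, M⁻¹ v⟩). -/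
open MeasureTheory ProbabilityTheory

open Matrix in
/-- A regularized kernel matrix `K + c • 1` with `K` positive semidefinite and `0 < c` is positive
definite. -/
theorem Matrix.PosSemidef.add_smul_one_posDef {n : Type*} [Fintype n] [DecidableEq n]
    {K : Matrix n n ℝ} (hK : K.PosSemidef) {c : ℝ} (hc : 0 < c) :
    (K + c • (1 : Matrix n n ℝ)).PosDef :=
  Matrix.PosDef.posSemidef_add hK (Matrix.PosDef.one.smul hc)

open Matrix in
/-- The quadratic form of a block matrix with scalar corner `c`, symmetric border `s • v` and
block `s • M`, evaluated at `(1, -M⁻¹ v)`, is `c` minus `s` times `⟨v, M⁻¹ v⟩`. -/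
theorem Matrix.sum_cons_neg_inv_mulVec_quadratic {N : ℕ} {M : Matrix (Fin N) (Fin N) ℝ}
    (hM : IsUnit M.det) {v : Fin N → ℝ} {c s : ℝ}
    {S : Matrix (Fin (N + 1)) (Fin (N + 1)) ℝ} (h00 : S 0 0 = c)
    (h0s : ∀ j : Fin N, S 0 j.succ = s * v j) (hs0 : ∀ i : Fin N, S i.succ 0 = s * v i)
    (hss : ∀ i j : Fin N, S i.succ j.succ = s * M i j) :
    ∑ i, (Fin.cons 1 (-(M⁻¹ *ᵥ v)) : Fin (N + 1) → ℝ) i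
        * (S *ᵥ (Fin.cons 1 (-(M⁻¹ *ᵥ v)) : Fin (N + 1) → ℝ)) i
      = c - s * ∑ i, v i * (M⁻¹ *ᵥ v) i := by
  have hMb : M *ᵥ (M⁻¹ *ᵥ v) = v := by
    rw [mulVec_mulVec, mul_nonsing_inv _ hM, one_mulVec]
  generalize M⁻¹ *ᵥ v = b at hMb ⊢
  have hrow (i : Fin N) : ∑ j, M i j * b j = v i := congrFun hMb i
  simp [Fin.sum_univ_succ, mulVec, dotProduct, h00, h0s, hs0, hss, mul_assoc,
    ← Finset.mul_sum, hrow, sub_eq_add_neg]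

/-- If `(W₀, W₁, …, W_N)` is a centered Gaussian vector with block covariance
`Σ̄ = [[σ²κ + δ², σ²vᵀ], [σ²v, σ²K + δ²I]]`, then the sample-then-optimize output
`ĝ = W₀ + ⟨v, M⁻¹(y − (W₁,…,W_N))⟩` is Gaussian with mean `⟨v, M⁻¹y⟩` and variance
`δ² + σ²(κ − ⟨v, M⁻¹v⟩)`. -/
theorem stmt_8 {Ω : Type*} [MeasurableSpace Ω] (P : Measure Ω) [IsProbabilityMeasure P]
    (N : ℕ) (hN : 1 ≤ N)
    (K : Matrix (Fin N) (Fin N) ℝ) (hK : K.PosSemidef)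
    (v : Fin N → ℝ) (κ : ℝ) (σ δ : ℝ) (hσ : 0 < σ) (hδ : 0 < δ)
    (M : Matrix (Fin N) (Fin N) ℝ)
    (hM : M = K + (δ ^ 2 / σ ^ 2) • (1 : Matrix (Fin N) (Fin N) ℝ))
    (y : Fin N → ℝ)
    (Sbar : Matrix (Fin (N + 1)) (Fin (N + 1)) ℝ)
    (hS00 : Sbar 0 0 = σ ^ 2 * κ + δ ^ 2)
    (hS0s : ∀ j : Fin N, Sbar 0 j.succ = σ ^ 2 * v j)
    (hSs0 : ∀ i : Fin N, Sbar i.succ 0 = σ ^ 2 * v i)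
    (hSss : ∀ i j : Fin N,
      Sbar i.succ j.succ = σ ^ 2 * K i j + if i = j then δ ^ 2 else 0)
    (hSpsd : Sbar.PosSemidef)
    (W : Fin (N + 1) → Ω → ℝ) (hWmeas : ∀ i, Measurable (W i))
    (hGauss : ∀ a : Fin (N + 1) → ℝ,
      Measure.map (fun ω => ∑ i, a i * W i ω) P
        = gaussianReal 0 (Real.toNNReal (∑ i, a i * Sbar.mulVec a i)))
    (g : Ω → ℝ)
    (hg : g = fun ω => W 0 ω + ∑ i, v i * M⁻¹.mulVec (y - fun j => W j.succ ω) i) :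
    Measure.map g P
      = gaussianReal (∑ i, v i * M⁻¹.mulVec y i)
          (Real.toNNReal (δ ^ 2 + σ ^ 2 * (κ - ∑ i, v i * M⁻¹.mulVec v i))) := by
  have hMpd : M.PosDef := hM ▸ hK.add_smul_one_posDef (by positivity)
  have hdet : IsUnit M.det := hMpd.det_pos.ne'.isUnit
  have hMT : M⁻¹.transpose = M⁻¹ := by
    simpa [Matrix.IsHermitian, Matrix.conjTranspose_eq_transpose_of_trivial] using
      hMpd.inv.isHermitian
  have hblock (i j : Fin N) : Sbar i.succ j.succ = σ ^ 2 * M i j := by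
    rw [hSss, hM, Matrix.add_apply, Matrix.smul_apply, Matrix.one_apply]
    split_ifs
    · simp only [smul_eq_mul]
      field_simp
    · simp
  have hvar := Matrix.sum_cons_neg_inv_mulVec_quadratic hdet hS00 hS0s hSs0 hblock
  have hadj (w : Fin N → ℝ) :
      ∑ i, v i * M⁻¹.mulVec w i = ∑ i, M⁻¹.mulVec v i * w i := by
    change v ⬝ᵥ M⁻¹.mulVec w = M⁻¹.mulVec v ⬝ᵥ w
    rw [Matrix.dotProduct_mulVec, ← Matrix.mulVec_transpose, hMT]
  have hg' : g = (fun x => x + ∑ i, v i * M⁻¹.mulVec y i) ∘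
      fun ω => ∑ i, (Fin.cons 1 (-(M⁻¹.mulVec v)) : Fin (N + 1) → ℝ) i * W i ω := by
    funext ω
    simp only [hg, hadj, Function.comp_apply, Fin.sum_univ_succ, Fin.cons_zero, Fin.cons_succ,
      Pi.sub_apply, Pi.neg_apply, mul_sub, neg_mul, Finset.sum_sub_distrib,
      Finset.sum_neg_distrib]
    ring
  rw [hg', ← Measure.map_map (by fun_prop) (by fun_prop), hGauss, hvar,
    gaussianReal_map_add_const, zero_add]
  congr 2
  ring
end

section
/- Let N ≥ 1, let ι be a type, and let c : Fin N → ι be a map (assigning each of the N sample points to a leaf of a decision tree). Define the weak learner's kernel matrix M ∈ ℝ^{N×N} by M_{ij} = N / #{k : c(k) = c(i)} if c(i) = c(j), and M_{ij} = 0 otherwise. Then M is symmetric positive semidefinite and its operator norm as a linear map (ℝ^N, ‖·‖₂) → (ℝ^N, ‖·‖₂) equals N; consequently its spectral radius equals N. -/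
section LeafKernel

open scoped Matrix

variable {N : ℕ} {ι : Type*} [DecidableEq ι]

/-- The kernel matrix of a partition of `Fin N` into leaves, given by the labelling `c`. -/
noncomputable def leafKernel (c : Fin N → ι) : Matrix (Fin N) (Fin N) ℝ :=
  Matrix.of fun i j =>
    if c i = c j
      then (N : ℝ) / ((Finset.univ.filter fun l => c l = c i).card : ℝ)
      else 0

theorem leafKernel_isSymm (c : Fin N → ι) : (leafKernel c).IsSymm := by
  ext i j
  by_cases h : c i = c j
  · simp [leafKernel, h]
  · simp [leafKernel, h, Ne.symm h]

theorem card_leaf_ne_zero (c : Fin N → ι) (i : Fin N) :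
    ((Finset.univ.filter fun l => c l = c i).card : ℝ) ≠ 0 :=
  Nat.cast_ne_zero.2 (Finset.card_ne_zero_of_mem (a := i) (by simp))

theorem leafKernel_mulVec_one (c : Fin N → ι) :
    leafKernel c *ᵥ (fun _ => 1) = fun _ => (N : ℝ) := by
  ext i
  have h := card_leaf_ne_zero c i
  simp only [leafKernel, Matrix.mulVec, dotProduct, Matrix.of_apply, mul_one]
  simp_rw [eq_comm (a := c i)]
  rw [← Finset.sum_filter, Finset.sum_const, nsmul_eq_mul]
  field_simp

theorem leafKernel_mul_self (c : Fin N → ι) :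
    leafKernel c * leafKernel c = (N : ℝ) • leafKernel c := by
  ext i k
  have key : ∀ j, leafKernel c i j * leafKernel c j k = leafKernel c i j * leafKernel c i k := by
    intro j
    by_cases h : c i = c j
    · simp [leafKernel, h]
    · simp [leafKernel, h]
  have h1 := congrFun (leafKernel_mulVec_one c) i
  simp only [Matrix.mulVec, dotProduct, mul_one] at h1
  rw [Matrix.mul_apply, Finset.sum_congr rfl fun j _ => key j, ← Finset.sum_mul, h1]
  rfl

theorem leafKernel_posSemidef (c : Fin N → ι) : (leafKernel c).PosSemidef := by
  rcases Nat.eq_zero_or_pos N with rfl | hN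
  · rw [Subsingleton.elim (leafKernel c) 0]
    exact Matrix.PosSemidef.zero
  have hN' : (N : ℝ) ≠ 0 := by positivity
  have h : leafKernel c = (N : ℝ)⁻¹ • ((leafKernel c).conjTranspose * leafKernel c) := by
    rw [Matrix.conjTranspose_eq_transpose_of_trivial, leafKernel_isSymm c, leafKernel_mul_self,
      smul_smul, inv_mul_cancel₀ hN', one_smul]
  rw [h]
  exact (Matrix.posSemidef_conjTranspose_mul_self _).smul (by positivity)

theorem toEuclideanCLM_leafKernel_apply_one (c : Fin N → ι) :
    Matrix.toEuclideanCLM (𝕜 := ℝ) (leafKernel c) (WithLp.toLp 2 fun _ => 1) =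
      (N : ℝ) • WithLp.toLp 2 fun _ => 1 := by
  rw [Matrix.toEuclideanCLM_toLp, leafKernel_mulVec_one]
  ext
  simp

theorem natCast_mem_spectrum_toEuclideanCLM_leafKernel (hN : 1 ≤ N) (c : Fin N → ι) :
    (N : ℝ) ∈ spectrum ℝ (Matrix.toEuclideanCLM (𝕜 := ℝ) (leafKernel c)) := by
  rw [spectrum.mem_iff]
  intro hu
  obtain ⟨u, hu⟩ := hu
  have h0 : (u : EuclideanSpace ℝ (Fin N) →L[ℝ] EuclideanSpace ℝ (Fin N))
      (WithLp.toLp 2 fun _ => 1) = 0 := by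
    rw [hu, sub_apply, toEuclideanCLM_leafKernel_apply_one,
      Algebra.algebraMap_eq_smul_one]
    simp
  have h1 := congrArg (fun T : EuclideanSpace ℝ (Fin N) →L[ℝ] EuclideanSpace ℝ (Fin N) =>
    T (WithLp.toLp 2 fun _ => 1)) u.inv_mul
  simp only [mul_apply_eq_comp, h0, map_zero, one_apply_eq_self] at h1
  have h2 := congrArg (fun v : EuclideanSpace ℝ (Fin N) => v ⟨0, hN⟩) h1
  simp at h2

theorem norm_toEuclideanCLM_leafKernel (hN : 1 ≤ N) (c : Fin N → ι) :
    ‖Matrix.toEuclideanCLM (𝕜 := ℝ) (leafKernel c)‖ = N := by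
  have hne : Matrix.toEuclideanCLM (𝕜 := ℝ) (leafKernel c) ≠ 0 := by
    intro h
    have h1 := toEuclideanCLM_leafKernel_apply_one c
    rw [h] at h1
    have h2 := congrArg (fun v : EuclideanSpace ℝ (Fin N) => v ⟨0, hN⟩) h1
    simp only [zero_apply, PiLp.zero_apply, PiLp.smul_apply, smul_eq_mul, mul_one] at h2
    exact absurd (Nat.cast_eq_zero.1 h2.symm) (by omega)
  have h := CStarRing.norm_star_mul_self (x := Matrix.toEuclideanCLM (𝕜 := ℝ) (leafKernel c))
  rw [← map_star, ← map_mul, Matrix.star_eq_conjTranspose,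
    Matrix.conjTranspose_eq_transpose_of_trivial, leafKernel_isSymm c, leafKernel_mul_self,
    map_smul, norm_smul] at h
  simpa using (mul_right_cancel₀ (norm_ne_zero_iff.2 hne) h).symm

theorem spectralRadius_toEuclideanCLM_leafKernel (hN : 1 ≤ N) (c : Fin N → ι) :
    spectralRadius ℝ (Matrix.toEuclideanCLM (𝕜 := ℝ) (leafKernel c)) = (N : ENNReal) := by
  have : Nonempty (Fin N) := ⟨⟨0, hN⟩⟩
  apply le_antisymm
  · refine (spectrum.spectralRadius_le_nnnorm _).trans_eq ?_
    rw [← enorm_eq_nnnorm, ← ofReal_norm, norm_toEuclideanCLM_leafKernel hN c,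
      ENNReal.ofReal_natCast]
  · refine le_trans (le_of_eq ?_)
      (le_iSup₂ (f := fun (k : ℝ) (_ : k ∈ spectrum ℝ _) => (‖k‖₊ : ENNReal)) (N : ℝ)
        (natCast_mem_spectrum_toEuclideanCLM_leafKernel hN c))
    simp

end LeafKernel

/-- The weak learner's kernel matrix `M i j = N / #{l : c l = c i}` if `c i = c j` and `0`
otherwise is symmetric positive semidefinite, has ℓ²-operator norm equal to `N`, and hence
spectral radius equal to `N`. -/
theorem stmt_11 (N : ℕ) (hN : 1 ≤ N) {ι : Type*} [DecidableEq ι] (c : Fin N → ι)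
    (M : Matrix (Fin N) (Fin N) ℝ)
    (hM : M = Matrix.of fun i j =>
      if c i = c j
        then (N : ℝ) / ((Finset.univ.filter fun l => c l = c i).card : ℝ)
        else 0) :
    M.IsSymm ∧ M.PosSemidef ∧
    ‖Matrix.toEuclideanCLM (𝕜 := ℝ) M‖ = (N : ℝ) ∧
    spectralRadius ℝ (Matrix.toEuclideanCLM (𝕜 := ℝ) M) = (N : ENNReal) := by
  subst hM
  exact ⟨leafKernel_isSymm c, leafKernel_posSemidef c, norm_toEuclideanCLM_leafKernel hN c,
    spectralRadius_toEuclideanCLM_leafKernel hN c⟩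
end
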